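/- Assume (f) and (D1) with threshold α ∈ (0,1), and let φ be a wavefront profile of ρ_t + f(ρ)_x = (D(ρ)ρ_x)_x from ℓ⁻ ∈ [0,α) to ℓ⁺ ∈ (α,1] with speed c, normalized so that φ(0) = α and φ(ξ) < α for ξ < 0, and let ξ̄ ≥ 0 be the point with φ(ξ̄) = α and φ(ξ) > α for ξ > ξ̄. Then D(φ(ξ))φ′(ξ) → 0 as ξ → 0⁻ and D(φ(ξ))φ′(ξ) → 0 as ξ → ξ̄⁺. -/

import Mathlib

open Set Filter MeasureTheory Topology

/-- A traveling-wave profile of `ρ_t + f(ρ)_x = (D(ρ)ρ_x)_x` with speed `c`: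
a continuous `φ : ℝ → [0,1]`, differentiable off a countable set, with
`D(φ)φ'` locally integrable, satisfying the weak form of the profile ODE. -/
def IsTWProfile (f D : ℝ → ℝ) (c : ℝ) (φ : ℝ → ℝ) : Prop :=
  Continuous φ ∧ (∀ ξ, φ ξ ∈ Icc (0:ℝ) 1) ∧
  (∃ S : Set ℝ, S.Countable ∧ ∀ ξ ∉ S, DifferentiableAt ℝ φ ξ) ∧
  LocallyIntegrable (fun ξ => D (φ ξ) * deriv φ ξ) ∧
  ∀ ψ : ℝ → ℝ, ContDiff ℝ (⊤ : ℕ∞) ψ → HasCompactSupport ψ →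
    ∫ ξ, (D (φ ξ) * deriv φ ξ - f (φ ξ) + c * φ ξ) * deriv ψ ξ = 0

/-- A wavefront from `ℓm` to `ℓp`: a monotone, non-constant traveling-wave
profile with limits `ℓm` at `-∞` and `ℓp` at `+∞`. -/
def IsWavefront (f D : ℝ → ℝ) (c ℓm ℓp : ℝ) (φ : ℝ → ℝ) : Prop :=
  IsTWProfile f D c φ ∧ (Monotone φ ∨ Antitone φ) ∧ (∃ x y, φ x ≠ φ y) ∧
  Tendsto φ atBot (𝓝 ℓm) ∧ Tendsto φ atTop (𝓝 ℓp)

theorem aux_primitive (θ : ℝ → ℝ) (hθ : ContDiff ℝ (⊤ : ℕ∞) θ) (hc : HasCompactSupport θ)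
    (h0 : ∫ x, θ x = 0) :
    ∃ ψ : ℝ → ℝ, ContDiff ℝ (⊤ : ℕ∞) ψ ∧ HasCompactSupport ψ ∧ deriv ψ = θ := by
  obtain ⟨R, hR⟩ := hc.isCompact.isBounded.subset_closedBall 0
  have hz : ∀ x, R < |x| → θ x = 0 := by
    intro x hx
    by_contra h
    have := hR (subset_tsupport θ h)
    simp only [Metric.mem_closedBall, dist_zero_right, Real.norm_eq_abs] at this
    linarith
  set a : ℝ := -(|R| + 1) with ha
  have hRa := le_abs_self R
  have hR0 := abs_nonneg R
  have hd : ∀ x, HasDerivAt (fun u => ∫ t in a..u, θ t) (θ x) x := fun x =>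
    intervalIntegral.integral_hasDerivAt_right (hθ.continuous.intervalIntegrable _ _)
      (hθ.continuous.stronglyMeasurableAtFilter _ _) hθ.continuous.continuousAt
  have hdd : deriv (fun u => ∫ t in a..u, θ t) = θ := funext fun x => (hd x).deriv
  refine ⟨fun u => ∫ t in a..u, θ t, ?_, ?_, hdd⟩
  · refine contDiff_infty_iff_deriv.2 ⟨fun x => (hd x).differentiableAt, ?_⟩
    rw [hdd]; exact hθ
  · refine HasCompactSupport.intro (K := Icc a (-a)) isCompact_Icc ?_
    intro x hx
    rw [mem_Icc, not_and_or, not_le, not_le] at hx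
    rcases hx with hx | hx
    · apply intervalIntegral.integral_zero_ae
      refine Eventually.of_forall fun t ht => hz t ?_
      rw [uIoc_of_ge hx.le] at ht
      have : -t ≤ |t| := neg_le_abs t
      have := ht.2
      linarith
    · show ∫ t in a..x, θ t = 0
      rw [intervalIntegral.integral_eq_integral_of_support_subset, h0]
      intro t ht
      have h1 : |t| ≤ R := by
        by_contra h
        exact ht (hz t (not_le.1 h))
      rw [abs_le] at h1
      constructor <;> linarith

theorem aux_const (G : ℝ → ℝ) (hG : LocallyIntegrable G)
    (h : ∀ ψ : ℝ → ℝ, ContDiff ℝ (⊤ : ℕ∞) ψ → HasCompactSupport ψ →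
      ∫ ξ, G ξ * deriv ψ ξ = 0) : ∃ k : ℝ, ∀ᵐ ξ, G ξ = k := by
  let b : ContDiffBump (0:ℝ) := default
  let η : ℝ → ℝ := b.normed volume
  have hη : ContDiff ℝ (⊤ : ℕ∞) η := b.contDiff_normed
  have hηc : HasCompactSupport η := b.hasCompactSupport_normed
  have hη1 : ∫ x, η x = 1 := b.integral_normed
  refine ⟨∫ x, G x * η x, ?_⟩
  set k := ∫ x, G x * η x with hk
  refine ae_eq_of_integral_contDiff_smul_eq hG (locallyIntegrable_const k) ?_
  intro χ hχ hχc
  have hχi : Integrable χ := hχ.continuous.integrable_of_hasCompactSupport hχc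
  have hηi : Integrable η := hη.continuous.integrable_of_hasCompactSupport hηc
  obtain ⟨ψ, h1, h2, h3⟩ := aux_primitive (fun x => χ x - (∫ y, χ y) * η x)
    (hχ.sub (contDiff_const.mul hη)) (hχc.sub hηc.mul_left) (by
      rw [integral_sub hχi (hηi.const_mul _), integral_const_mul, hη1]; ring)
  have h4 := h ψ h1 h2
  rw [h3] at h4
  have i1 : Integrable (fun x => G x * χ x) :=
    hG.integrable_smul_right_of_hasCompactSupport hχ.continuous hχc
  have i2 : Integrable (fun x => G x * η x) :=
    hG.integrable_smul_right_of_hasCompactSupport hη.continuous hηc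
  have h5 : ∫ x, G x * (χ x - (∫ y, χ y) * η x)
      = (∫ x, G x * χ x) - (∫ y, χ y) * k := by
    rw [hk, ← integral_const_mul, ← integral_sub i1 (i2.const_mul _)]
    congr 1; ext x; ring
  rw [h5] at h4
  simp only [smul_eq_mul]
  rw [integral_mul_const]
  have : ∫ x, χ x * G x = ∫ x, G x * χ x := by congr 1; ext x; ring
  linarith

theorem aux_C1 (φ E H : ℝ → ℝ) (p q : ℝ) (hφ : Continuous φ) (S : Set ℝ) (hS : S.Countable)
    (hd : ∀ ξ ∉ S, DifferentiableAt ℝ φ ξ) (hE : Continuous E)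
    (hE0 : ∀ x ∈ Ioo p q, E x ≠ 0) (hH : Continuous H)
    (hae : ∀ᵐ x, E x * deriv φ x = H x) :
    ∀ x ∈ Ioo p q, E x * deriv φ x = H x := by
  intro x hx
  have hg : ContinuousOn (fun x => H x / E x) (Ioo p q) :=
    hH.continuousOn.div hE.continuousOn hE0
  have hae' : ∀ᵐ y, y ∈ Ioo p q → H y / E y = deriv φ y := by
    filter_upwards [hae] with y hy hyI
    rw [← hy, mul_div_cancel_left₀ _ (hE0 y hyI)]
  have hint : ∀ y ∈ Ioo p q, IntervalIntegrable (fun x => H x / E x) volume x y := fun y hy =>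
    (hg.mono (ordConnected_Ioo.uIcc_subset hx hy)).intervalIntegrable
  have key : ∀ y ∈ Ioo p q, φ y = φ x + ∫ t in x..y, H t / E t := by
    intro y hy
    have hsub : uIoc x y ⊆ Ioo p q := uIoc_subset_uIcc.trans (ordConnected_Ioo.uIcc_subset hx hy)
    have hcongr : ∀ᵐ t, t ∈ uIoc x y → H t / E t = deriv φ t := by
      filter_upwards [hae'] with t ht hI using ht (hsub hI)
    have hi : IntervalIntegrable (deriv φ) volume x y :=
      (hint y hy).congr_ae ((ae_restrict_iff' measurableSet_uIoc).2 hcongr)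
    have := integral_eq_of_hasDerivAt_off_countable φ (deriv φ) hS hφ.continuousOn
      (fun t ht => (hd t ht.2).hasDerivAt) hi
    rw [intervalIntegral.integral_congr_ae hcongr, this]; ring
  have hnx : Ioo p q ∈ 𝓝 x := isOpen_Ioo.mem_nhds hx
  have hder : HasDerivAt (fun y => φ x + ∫ t in x..y, H t / E t) (H x / E x) x := by
    refine HasDerivAt.const_add _ ?_
    exact intervalIntegral.integral_hasDerivAt_right (hint x hx)
      (hg.stronglyMeasurableAtFilter isOpen_Ioo x hx) (hg.continuousAt hnx)
  have := hder.congr_of_eventuallyEq (f₁ := φ) (by filter_upwards [hnx] with y hy using key y hy)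
  rw [this.deriv, mul_div_cancel₀ _ (hE0 x hx)]

/-- Formula (5.1) in Lemma 2.3's proof: `D(φ)φ' → 0` as `ξ → 0⁻` and as
`ξ → ξ̄⁺`, where `ξ̄ ≥ 0` is where the profile leaves the level `α`. -/
theorem stmt14 (f D φ : ℝ → ℝ) (α ℓm ℓp c ξbar : ℝ)
    (hf : ContDiffOn ℝ 1 f (Icc 0 1)) (hf0 : f 0 = 0)
    (hD : ContDiffOn ℝ 1 D (Icc 0 1))
    (hα : α ∈ Ioo (0:ℝ) 1)
    (hDpos : ∀ ρ ∈ Ioo (0:ℝ) α, 0 < D ρ) (hDneg : ∀ ρ ∈ Ioo α 1, D ρ < 0)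
    (hℓm : ℓm ∈ Ico (0:ℝ) α) (hℓp : ℓp ∈ Ioc α 1)
    (hwf : IsWavefront f D c ℓm ℓp φ)
    (hnorm0 : φ 0 = α) (hnorm : ∀ ξ < (0:ℝ), φ ξ < α)
    (hξbar : 0 ≤ ξbar) (hξbar1 : φ ξbar = α) (hξbar2 : ∀ ξ, ξbar < ξ → α < φ ξ) :
    Tendsto (fun ξ => D (φ ξ) * deriv φ ξ) (𝓝[<] (0:ℝ)) (𝓝 0) ∧
    Tendsto (fun ξ => D (φ ξ) * deriv φ ξ) (𝓝[>] ξbar) (𝓝 0) := by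
  obtain ⟨⟨hφ, hφI, ⟨S, hS, hd⟩, hloc, hweak⟩, hmon, -, -, -⟩ := hwf
  have hmono : Monotone φ := by
    rcases hmon with h | h
    · exact h
    · exfalso
      have h1 := hnorm (-1) (by norm_num)
      have h2 := h (show (-1:ℝ) ≤ 0 by norm_num)
      linarith
  have hfc : Continuous (fun ξ => f (φ ξ)) := hf.continuousOn.comp_continuous hφ hφI
  have hDc : Continuous (fun ξ => D (φ ξ)) := hD.continuousOn.comp_continuous hφ hφI
  obtain ⟨k, hk⟩ := aux_const (fun ξ => D (φ ξ) * deriv φ ξ - f (φ ξ) + c * φ ξ)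
    ((hloc.sub hfc.locallyIntegrable).add (continuous_const.mul hφ).locallyIntegrable) hweak
  set H : ℝ → ℝ := fun ξ => k + f (φ ξ) - c * φ ξ with hHdef
  have hH : Continuous H := (continuous_const.add hfc).sub (continuous_const.mul hφ)
  have hae : ∀ᵐ x, D (φ x) * deriv φ x = H x := by
    filter_upwards [hk] with x hx
    simp only [hHdef]; linarith
  have hφ' : ∀ x, 0 ≤ deriv φ x := fun x => hmono.deriv_nonneg
  -- left interval
  obtain ⟨p, hp, hpI⟩ : ∃ p < 0, ∀ x ∈ Ioo p 0, 0 < D (φ x) := by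
    have : ∀ᶠ x in 𝓝 (0:ℝ), 0 < φ x :=
      hφ.continuousAt.eventually (lt_mem_nhds (by rw [hnorm0]; exact hα.1))
    obtain ⟨ε, hε, h⟩ := Metric.eventually_nhds_iff.1 this
    refine ⟨-ε, by linarith, fun x hx => hDpos _ ⟨h ?_, hnorm x hx.2⟩⟩
    rw [Real.dist_eq, sub_zero, abs_lt]
    exact ⟨hx.1, by linarith [hx.2]⟩
  obtain ⟨q, hq, hqI⟩ : ∃ q > ξbar, ∀ x ∈ Ioo ξbar q, D (φ x) < 0 := by
    have : ∀ᶠ x in 𝓝 ξbar, φ x < 1 :=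
      hφ.continuousAt.eventually (gt_mem_nhds (by rw [hξbar1]; exact hα.2))
    obtain ⟨ε, hε, h⟩ := Metric.eventually_nhds_iff.1 this
    refine ⟨ξbar + ε, by linarith, fun x hx => hDneg _ ⟨hξbar2 x hx.1, h ?_⟩⟩
    rw [Real.dist_eq, abs_lt]
    constructor <;> linarith [hx.1, hx.2]
  have hL := aux_C1 φ _ H p 0 hφ S hS hd hDc (fun x hx => (hpI x hx).ne') hH hae
  have hR := aux_C1 φ _ H ξbar q hφ S hS hd hDc (fun x hx => (hqI x hx).ne) hH hae
  have hLn : Ioo p 0 ∈ 𝓝[<] (0:ℝ) := Ioo_mem_nhdsLT hp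
  have hRn : Ioo ξbar q ∈ 𝓝[>] ξbar := Ioo_mem_nhdsGT hq
  have tL : Tendsto H (𝓝[<] (0:ℝ)) (𝓝 (H 0)) := hH.continuousAt.tendsto.mono_left nhdsWithin_le_nhds
  have tR : Tendsto H (𝓝[>] ξbar) (𝓝 (H ξbar)) :=
    hH.continuousAt.tendsto.mono_left nhdsWithin_le_nhds
  have hHH : H ξbar = H 0 := by simp only [hHdef, hnorm0, hξbar1]
  have h1 : 0 ≤ H 0 := by
    refine ge_of_tendsto tL ?_
    filter_upwards [hLn] with x hx
    rw [← hL x hx]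
    exact mul_nonneg (hpI x hx).le (hφ' x)
  have h2 : H ξbar ≤ 0 := by
    refine le_of_tendsto tR ?_
    filter_upwards [hRn] with x hx
    rw [← hR x hx]
    exact mul_nonpos_of_nonpos_of_nonneg (hqI x hx).le (hφ' x)
  have h3 : H 0 = 0 := by linarith
  rw [hHH, h3] at tR
  rw [h3] at tL
  constructor
  · refine tL.congr' ?_
    filter_upwards [hLn] with x hx using (hL x hx).symm
  · refine tR.congr' ?_
    filter_upwards [hRn] with x hx using (hR x hx).symm
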